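/- Let n ≥ 5 and 3 ≤ K ≤ n−2, and let uv ∈ E. The inequality x_{u,v} ≥ 0 is facet-defining for P_{n,K} if and only if uv ∉ {{1,2},{1,3},{2,3}}. -/

import Mathlib

/-- A `K`-partition of `V = {1,…,n}`: a family of `K` nonempty pairwise disjoint
subsets of `V` (clusters) whose union is `V`. -/
structure KPartition (n K : ℕ) where
  parts : Finset (Finset ℕ)
  card_parts : parts.card = K
  parts_nonempty : ∀ C ∈ parts, C.Nonempty
  parts_disjoint : ∀ C ∈ parts, ∀ D ∈ parts, C ≠ D → Disjoint C D
  parts_cover : parts.sup id = Finset.Icc 1 n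

/-- The ambient space: one (symmetric) edge coordinate for each pair of vertices and one
representative coordinate for each vertex (only the coordinates of edges `uv ∈ E` and of
vertices `v ∈ {4,…,n}` are actually used; the remaining ones are affinely determined, so
affine dimensions agree with those in `ℝ^{|E|+n-3}`). -/
abbrev GPoint : Type := (ℕ × ℕ → ℝ) × (ℕ → ℝ)

open Classical in
/-- The characteristic vector of a `K`-partition: edge component `x_{u,v} = 1` iff `u` and `v`
lie in the same cluster; representative component `x_v = 1` (for `v ∈ {4,…,n}`) iff `v` is the
smallest element of its cluster. -/
noncomputable def charVec (n K : ℕ) (π : KPartition n K) : GPoint :=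
  ⟨fun p => if ∃ C ∈ π.parts, p.1 ∈ C ∧ p.2 ∈ C then 1 else 0,
   fun v => if 4 ≤ v ∧ ∃ C ∈ π.parts, v ∈ C ∧ ∀ w ∈ C, v ≤ w then 1 else 0⟩

/-- `P_{n,K}`: the convex hull of the characteristic vectors of all `K`-partitions. -/
noncomputable def PolyP (n K : ℕ) : Set GPoint :=
  convexHull ℝ {x | ∃ π : KPartition n K, x = charVec n K π}

/-- Affine dimension of a set: the rank of the direction of its affine span. -/
noncomputable def adim (s : Set GPoint) : ℕ :=
  Module.finrank ℝ (affineSpan ℝ s).direction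

/-- `f x ≤ b` is a valid inequality for `P_{n,K}` which is facet-defining. -/
def IsFacetLe (n K : ℕ) (f : GPoint → ℝ) (b : ℝ) : Prop :=
  (∀ x ∈ PolyP n K, f x ≤ b) ∧
  adim {x | x ∈ PolyP n K ∧ f x = b} + 1 = adim (PolyP n K)

/-- `f x ≥ b` is a valid inequality for `P_{n,K}` which is facet-defining. -/
def IsFacetGe (n K : ℕ) (f : GPoint → ℝ) (b : ℝ) : Prop :=
  (∀ x ∈ PolyP n K, b ≤ f x) ∧
  adim {x | x ∈ PolyP n K ∧ f x = b} + 1 = adim (PolyP n K)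

/-- Sum of the edge components of `x` over the edges with both endpoints in `A`. -/
noncomputable def edgeSum (A : Finset ℕ) (x : GPoint) : ℝ :=
  ∑ e ∈ A.offDiag.filter (fun e => e.1 < e.2), x.1 e

open Finset

theorem ite_one_zero_congr {P Q : Prop} {_ : Decidable P} {_ : Decidable Q} (h : P ↔ Q) :
    (if P then (1 : ℝ) else 0) = if Q then 1 else 0 :=
  if_congr h rfl rfl

/-- The symmetric unit vector of the edge `ij`. -/
noncomputable def edgeVec (i j : ℕ) : GPoint :=
  (Pi.single (i, j) 1 + Pi.single (j, i) 1, 0)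

/-- The unit vector of the representative coordinate of `w`. -/
noncomputable def repVec (w : ℕ) : GPoint := (0, Pi.single w 1)

open Classical in
/-- The characteristic vector of the partition of `{1,…,n}` into the colour classes of `c`. -/
noncomputable def colorVec (n : ℕ) (c : ℕ → ℕ) : GPoint :=
  ⟨fun p => if p.1 ∈ Icc 1 n ∧ p.2 ∈ Icc 1 n ∧ c p.1 = c p.2 then 1 else 0,
   fun w => if 4 ≤ w ∧ w ∈ Icc 1 n ∧ ∀ i ∈ Icc 1 n, c i = c w → w ≤ i then 1 else 0⟩

/-- The characteristic vectors of the partitions separating `u` from `v`. -/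
def separatingVecs (n K u v : ℕ) : Set GPoint :=
  {x | ∃ π : KPartition n K, x = charVec n K π ∧ x.1 (u, v) = 0}

/-- The partition of `{1,…,n}` into the colour classes of `c`. -/
def colorPartition (n K : ℕ) (c : ℕ → ℕ) (hlt : ∀ i ∈ Icc 1 n, c i < K)
    (hsurj : ∀ k < K, ∃ i ∈ Icc 1 n, c i = k) : KPartition n K where
  parts := (range K).image fun k => (Icc 1 n).filter fun i => c i = k
  card_parts := by
    rw [card_image_of_injOn, card_range]
    intro k hk l _ h
    obtain ⟨i, hi, rfl⟩ := hsurj k (by simpa using hk)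
    have : i ∈ (Icc 1 n).filter fun j => c j = l := by
      have h : (Icc 1 n).filter (fun j => c j = c i) = (Icc 1 n).filter fun j => c j = l := h
      rw [← h]; simpa using hi
    exact (mem_filter.1 this).2
  parts_nonempty := by
    intro C hC
    obtain ⟨k, hk, rfl⟩ := mem_image.1 hC
    obtain ⟨i, hi, h⟩ := hsurj k (by simpa using hk)
    exact ⟨i, mem_filter.2 ⟨hi, h⟩⟩
  parts_disjoint := by
    intro C hC D hD hne
    obtain ⟨k, hk, rfl⟩ := mem_image.1 hC
    obtain ⟨l, hl, rfl⟩ := mem_image.1 hD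
    rw [Finset.disjoint_left]
    intro i hi hi'
    exact hne (by rw [← (mem_filter.1 hi).2, ← (mem_filter.1 hi').2])
  parts_cover := by
    ext i
    simp only [mem_sup, mem_image, id]
    constructor
    · rintro ⟨_, ⟨k, _, rfl⟩, hi⟩
      exact (mem_filter.1 hi).1
    · intro hi
      exact ⟨_, ⟨c i, by simpa using hlt i hi, rfl⟩, mem_filter.2 ⟨hi, rfl⟩⟩

theorem charVec_colorPartition (n K : ℕ) (c : ℕ → ℕ) (hlt : ∀ i ∈ Icc 1 n, c i < K)
    (hsurj : ∀ k < K, ∃ i ∈ Icc 1 n, c i = k) :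
    charVec n K (colorPartition n K c hlt hsurj) = colorVec n c := by
  unfold charVec colorVec colorPartition
  refine Prod.ext (funext fun p => ?_) (funext fun w => ?_)
  · refine ite_one_zero_congr ?_
    simp only [mem_image]
    constructor
    · rintro ⟨_, ⟨k, _, rfl⟩, h₁, h₂⟩
      rw [mem_filter] at h₁ h₂
      exact ⟨h₁.1, h₂.1, h₁.2.trans h₂.2.symm⟩
    · rintro ⟨h₁, h₂, h⟩
      exact ⟨_, ⟨c p.1, by simpa using hlt _ h₁, rfl⟩, mem_filter.2 ⟨h₁, rfl⟩,
        mem_filter.2 ⟨h₂, h.symm⟩⟩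
  · refine ite_one_zero_congr (and_congr_right fun _ => ?_)
    simp only [mem_image]
    constructor
    · rintro ⟨_, ⟨k, _, rfl⟩, h₁, h₂⟩
      rw [mem_filter] at h₁
      exact ⟨h₁.1, fun i hi h => h₂ i (mem_filter.2 ⟨hi, h.trans h₁.2⟩)⟩
    · rintro ⟨h₁, h₂⟩
      exact ⟨_, ⟨c w, by simpa using hlt _ h₁, rfl⟩, mem_filter.2 ⟨h₁, rfl⟩,
        fun i hi => h₂ i (mem_filter.1 hi).1 (mem_filter.1 hi).2⟩

theorem exists_surjOn_range (T : Finset ℕ) (m : ℕ) (hm : 0 < m) (hT : m ≤ T.card) :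
    ∃ f : ℕ → ℕ, (∀ i, f i < m) ∧ ∀ k < m, ∃ i ∈ T, f i = k := by
  have : Nonempty (Fin m) := ⟨⟨0, hm⟩⟩
  obtain ⟨e⟩ : Nonempty (Fin m ↪ T) := Function.Embedding.nonempty_of_card_le (by simpa using hT)
  refine ⟨fun i => if h : i ∈ T then (Function.invFun e ⟨i, h⟩ : Fin m) else 0, fun i => ?_,
    fun k hk => ⟨e ⟨k, hk⟩, (e ⟨k, hk⟩).2, ?_⟩⟩
  · dsimp only
    split_ifs
    · exact Fin.is_lt _
    · exact hm
  · simp [Function.leftInverse_invFun e.injective _]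

/-- `c` with the colours of `x` and `y` replaced by `s` and `t`. -/
def recolor (c : ℕ → ℕ) (x y s t : ℕ) : ℕ → ℕ :=
  fun i => if i = x then s else if i = y then t else c i

/-- The second difference over the placements of `x` and `y` into two classes. -/
noncomputable def squareVec (n : ℕ) (c : ℕ → ℕ) (x y : ℕ) : GPoint :=
  (colorVec n (recolor c x y 0 0) - colorVec n (recolor c x y 0 1)) -
    (colorVec n (recolor c x y 1 0) - colorVec n (recolor c x y 1 1))

theorem squareVec_fst (n : ℕ) (c : ℕ → ℕ) (x y : ℕ) (hx : x ∈ Icc 1 n) (hy : y ∈ Icc 1 n)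
    (hxy : x ≠ y) : (squareVec n c x y).1 = (2 : ℝ) • (edgeVec x y).1 := by
  funext ⟨i, j⟩
  simp only [squareVec, colorVec, recolor, edgeVec, Prod.fst_sub, Pi.sub_apply, Pi.smul_apply,
    Pi.add_apply, Pi.single_apply, Prod.mk.injEq, smul_eq_mul]
  by_cases hi : i ∈ Icc 1 n <;> by_cases hj : j ∈ Icc 1 n <;>
    by_cases hix : i = x <;> by_cases hiy : i = y <;>
    by_cases hjx : j = x <;> by_cases hjy : j = y <;>
    first
    | (exfalso; simp_all; done)
    | (simp [*, eq_comm]; done)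
    | (simp [*, eq_comm]; norm_num; done)
    | simp_all

theorem squareVec_snd_eq_zero (n : ℕ) (c : ℕ → ℕ) (x y w : ℕ) (hw : w ∉ Icc 4 n) :
    (squareVec n c x y).2 w = 0 := by
  have : ∀ d, (colorVec n d).2 w = 0 := fun d => by
    simp only [colorVec]
    exact if_neg fun h => hw (mem_Icc.2 ⟨h.1, (mem_Icc.1 h.2.1).2⟩)
  simp [squareVec, this]

open Classical in
theorem squareVec_snd (n : ℕ) (c : ℕ → ℕ) (x y p q : ℕ) (hx : x ∈ Icc 1 n) (hy : y ∈ Icc 1 n)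
    (hp : p ∈ Icc 1 n) (hq : q ∈ Icc 1 n) (hpq : p ≠ q)
    (hxy : x ≠ y) (hxp : x ≠ p) (hxq : x ≠ q) (hyp : y ≠ p) (hyq : y ≠ q) (hx3 : x ≤ 3)
    (hy3 : y ≤ 3) (cp : c p = 0) (cq : c q = 1) (hc : ∀ i, i ≠ p → i ≠ q → 2 ≤ c i) :
    (squareVec n c x y).2 =
      (if 4 ≤ p then (repVec p).2 else 0) + if 4 ≤ q then (repVec q).2 else 0 := by
  have key : ∀ s t w, 4 ≤ w → w ∈ Icc 1 n → s ≤ 1 → t ≤ 1 →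
      (colorVec n (recolor c x y s t)).2 w =
      if s ≠ c w ∧ t ≠ c w ∧ ∀ i ∈ Icc 1 n, i ≠ x → i ≠ y → c i = c w → w ≤ i then 1 else 0 := by
    intro s t w hw hwn hs ht
    refine ite_one_zero_congr ?_
    have hwx : w ≠ x := by omega
    have hwy : w ≠ y := by omega
    simp only [recolor, if_neg hwx, if_neg hwy]
    constructor
    · rintro ⟨-, -, h⟩
      refine ⟨fun e => ?_, fun e => ?_, fun i hi hix hiy e => ?_⟩
      · have := h x hx (by simpa using e); omega
      · have := h y hy (by simpa [hxy.symm] using e); omega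
      · exact h i hi (by simpa [hix, hiy] using e)
    · rintro ⟨h₁, h₂, h₃⟩
      refine ⟨hw, hwn, fun i hi e => ?_⟩
      split_ifs at e with h h'
      · exact absurd e h₁
      · exact absurd e h₂
      · exact h₃ i hi h h' e
  funext w
  by_cases hw : w ∈ Icc 4 n
  · have hw' := mem_Icc.1 hw
    have hwn : w ∈ Icc 1 n := mem_Icc.2 ⟨by omega, hw'.2⟩
    simp only [squareVec, Prod.snd_sub, Pi.sub_apply, Pi.add_apply]
    rw [key _ _ _ hw'.1 hwn (by omega) (by omega), key _ _ _ hw'.1 hwn (by omega) (by omega),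
      key _ _ _ hw'.1 hwn (by omega) (by omega), key _ _ _ hw'.1 hwn (by omega) (by omega)]
    by_cases hwp : w = p
    · subst hwp
      have : ∀ i, 1 ≤ i → i ≤ n → ¬i = x → ¬i = y → c i = 0 → w ≤ i := by
        intro i _ _ _ _ e
        by_contra h
        by_cases hiq : i = q
        · subst hiq; omega
        · have := hc i (by omega) hiq; omega
      have h4 : ∀ r : ℕ → ℝ, (if 4 ≤ q then r else 0) w = if 4 ≤ q then r w else 0 := by
        intro r; split_ifs <;> rfl
      simpa [cp, hw'.1, repVec, h4, hpq] using this
    by_cases hwq : w = q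
    · subst hwq
      have : ∀ i, 1 ≤ i → i ≤ n → ¬i = x → ¬i = y → c i = 1 → w ≤ i := by
        intro i _ _ _ _ e
        by_contra h
        by_cases hip : i = p
        · subst hip; omega
        · have := hc i hip (by omega); omega
      have h4 : ∀ r : ℕ → ℝ, (if 4 ≤ p then r else 0) w = if 4 ≤ p then r w else 0 := by
        intro r; split_ifs <;> rfl
      simpa [cq, hw'.1, repVec, h4, hwp] using this
    · have hcw := hc w hwp hwq
      have h0 : 0 ≠ c w := by omega
      have h1 : 1 ≠ c w := by omega
      have h4 : ∀ z : ℕ, w ≠ z → (if 4 ≤ z then (repVec z).2 else 0) w = 0 := by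
        intro z hz; split_ifs <;> simp [repVec, hz]
      simp [h0, h1, h4 p hwp, h4 q hwq]
  · rw [squareVec_snd_eq_zero _ _ _ _ _ hw]
    have h4 : ∀ z ∈ Icc 1 n, (if 4 ≤ z then (repVec z).2 else 0) w = 0 := by
      intro z hz
      split_ifs with h
      · have : w ≠ z := by rintro rfl; exact hw (mem_Icc.2 ⟨h, (mem_Icc.1 hz).2⟩)
        simp [repVec, this]
      · rfl
    rw [Pi.add_apply, h4 p hp, h4 q hq, add_zero]

/-- A colouring in which `p` and `q` have private colours, and the colours stay surjective
however `x` and `y` are recoloured; `u` and `v` remain separated. -/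
theorem exists_squareVec_mem (n K u v x y p q : ℕ) (hK1 : 3 ≤ K) (hK2 : K + 2 ≤ n)
    (hp : p ∈ Icc 1 n) (hq : q ∈ Icc 1 n) (hpq : p ≠ q)
    (hxp : x ≠ p) (hxq : x ≠ q) (hyp : y ≠ p) (hyq : y ≠ q) (huv : u ≠ v)
    (hsep : (u ≠ x ∧ u ≠ y ∧ v ≠ x ∧ v ≠ y ∧ (u = p ∨ u = q ∨ v = p ∨ v = q)) ∨
      ((u = x ∨ u = y) ∧ v ≠ x ∧ v ≠ y ∧ v ≠ p ∧ v ≠ q) ∨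
      ((v = x ∨ v = y) ∧ u ≠ x ∧ u ≠ y ∧ u ≠ p ∧ u ≠ q)) :
    ∃ c : ℕ → ℕ, c p = 0 ∧ c q = 1 ∧ (∀ i, i ≠ p → i ≠ q → 2 ≤ c i) ∧
      squareVec n c x y ∈ vectorSpan ℝ (separatingVecs n K u v) := by
  obtain ⟨f, hf, hfs⟩ := exists_surjOn_range (Icc 1 n \ {x, y, p, q}) (K - 2) (by omega) (by
    have h1 := le_card_sdiff ({x, y, p, q} : Finset ℕ) (Icc 1 n)
    have h2 := card_le_four (a := x) (b := y) (c := p) (d := q)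
    simp only [Nat.card_Icc] at h1
    omega)
  let c : ℕ → ℕ := fun i => if i = p then 0 else if i = q then 1 else 2 + f i
  have cp : c p = 0 := if_pos rfl
  have cq : c q = 1 := by simp [c, hpq.symm]
  have hc : ∀ i, i ≠ p → i ≠ q → 2 ≤ c i := fun i h h' => by simp [c, h, h']
  have hcK : ∀ i, c i < K := fun i => by
    have := hf i
    simp only [c]; split_ifs <;> omega
  have mem : ∀ s t, s ≤ 1 → t ≤ 1 →
      colorVec n (recolor c x y s t) ∈ separatingVecs n K u v := by
    intro s t hs ht
    refine ⟨colorPartition n K (recolor c x y s t) ?_ ?_, (charVec_colorPartition ..).symm, ?_⟩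
    · intro i _
      have := hcK i
      simp only [recolor]; split_ifs <;> omega
    · intro k hk
      rcases Nat.lt_or_ge k 2 with h | h
      · interval_cases k
        · exact ⟨p, hp, by simp [recolor, hxp.symm, hyp.symm, cp]⟩
        · exact ⟨q, hq, by simp [recolor, hxq.symm, hyq.symm, cq]⟩
      · obtain ⟨i, hi, e⟩ := hfs (k - 2) (by omega)
        simp only [mem_sdiff, mem_insert, mem_singleton, not_or] at hi
        refine ⟨i, hi.1, ?_⟩
        simp only [recolor, c, hi, if_false]
        omega
    · refine if_neg fun h => ?_
      have h := h.2.2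
      have hcu := hc u
      have hcv := hc v
      simp only [recolor] at h
      grind
  refine ⟨c, cp, cq, hc, ?_⟩
  have sub : ∀ {a b}, a ∈ separatingVecs n K u v → b ∈ separatingVecs n K u v →
      a - b ∈ vectorSpan ℝ (separatingVecs n K u v) := fun ha hb => vsub_mem_vectorSpan ℝ ha hb
  exact Submodule.sub_mem _ (sub (mem 0 0 (by omega) (by omega)) (mem 0 1 (by omega) (by omega)))
    (sub (mem 1 0 (by omega) (by omega)) (mem 1 1 (by omega) (by omega)))

theorem sum_smul_repVec (n : ℕ) (f : ℕ → ℝ) (hf : ∀ w, w ∉ Icc 4 n → f w = 0) :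
    ((0, f) : GPoint) = ∑ w ∈ Icc 4 n, f w • repVec w := by
  refine Prod.ext ?_ ?_
  · simp [Prod.fst_sum, repVec]
  · funext w
    by_cases hw : w ∈ Icc 4 n
    · simp [Prod.snd_sum, repVec, Finset.sum_apply, Pi.single_apply] at hw ⊢
      omega
    · simp [Prod.snd_sum, repVec, Finset.sum_apply, Pi.single_apply, hf w hw] at hw ⊢

theorem mem_of_edgeVec_mem_of_repVec_mem (n : ℕ) (M : Submodule ℝ GPoint)
    (hE : ∀ i ∈ Icc 1 n, ∀ j ∈ Icc 1 n, i ≠ j → edgeVec i j ∈ M)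
    (hR : ∀ w ∈ Icc 4 n, repVec w ∈ M) (x : GPoint)
    (hsupp : ∀ i j, ¬(i ∈ Icc 1 n ∧ j ∈ Icc 1 n ∧ i ≠ j) → x.1 (i, j) = 0)
    (hsymm : ∀ i j, x.1 (i, j) = x.1 (j, i)) (hrep : ∀ w, w ∉ Icc 4 n → x.2 w = 0) : x ∈ M := by
  have h₁ : ((x.1, 0) : GPoint) =
      ∑ p ∈ (Icc 1 n).offDiag, (x.1 p / 2) • edgeVec p.1 p.2 := by
    refine Prod.ext ?_ (by simp [Prod.snd_sum, edgeVec])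
    funext ⟨i, j⟩
    have hsum : ∀ a b, (∑ p ∈ (Icc 1 n).offDiag,
        if (a, b) = p then x.1 p / 2 else 0) = x.1 (a, b) / 2 := by
      intro a b
      rw [Finset.sum_ite_eq]
      split_ifs with h
      · rfl
      · rw [hsupp a b (by simpa [mem_offDiag] using h), zero_div]
    have : ∀ p ∈ (Icc 1 n).offDiag, ((x.1 p / 2) • edgeVec p.1 p.2).1 (i, j) =
        (if (i, j) = p then x.1 p / 2 else 0) + if (j, i) = p then x.1 p / 2 else 0 := by
      rintro ⟨a, b⟩ _
      simp only [edgeVec, Prod.smul_fst, Pi.smul_apply, Pi.add_apply, Pi.single_apply,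
        smul_eq_mul, Prod.mk.injEq, and_comm (a := j = a)]
      split_ifs <;> ring
    rw [Prod.fst_sum, Finset.sum_apply, sum_congr rfl this, sum_add_distrib, hsum, hsum,
      hsymm j i]
    ring
  have h₂ : x = (x.1, 0) + (0, x.2) := by simp
  rw [h₂, h₁, sum_smul_repVec n x.2 hrep]
  refine M.add_mem (M.sum_mem fun p hp => M.smul_mem _ ?_)
    (M.sum_mem fun w hw => M.smul_mem _ (hR w hw))
  have := mem_offDiag.1 hp
  exact hE _ this.1 _ this.2.1 this.2.2

theorem charVec_symm (n K : ℕ) (π : KPartition n K) (i j : ℕ) :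
    (charVec n K π).1 (i, j) = (charVec n K π).1 (j, i) := by
  simp only [charVec, and_comm (a := i ∈ _)]

theorem edgeVec_comm (i j : ℕ) : edgeVec i j = edgeVec j i := by
  simp only [edgeVec, add_comm]

theorem separatingVecs_comm (n K u v : ℕ) :
    separatingVecs n K u v = separatingVecs n K v u := by
  ext x
  refine exists_congr fun π => and_congr_right ?_
  rintro rfl
  rw [charVec_symm]

theorem repVec_mem_vectorSpan (n K u v : ℕ) (hK1 : 3 ≤ K) (hK2 : K + 2 ≤ n) (hu : u ∈ Icc 1 n)
    (hv : v ∈ Icc 1 n) (huv : u ≠ v) (hu4 : 4 ≤ u) (w : ℕ) (hw : w ∈ Icc 4 n) :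
    repVec w ∈ vectorSpan ℝ (separatingVecs n K u v) := by
  simp only [mem_Icc] at hu hv hw
  obtain ⟨x, y, z, hx, hy, hz, hxy, hxz, hyz, hvx, hvy⟩ : ∃ x y z : ℕ, (1 ≤ x ∧ x ≤ 3) ∧
      (1 ≤ y ∧ y ≤ 3) ∧ (1 ≤ z ∧ z ≤ 3) ∧ x ≠ y ∧ x ≠ z ∧ y ≠ z ∧ v ≠ x ∧ v ≠ y := by
    rcases Nat.lt_or_ge v 4 with h | h
    · have : v = 1 ∨ v = 2 ∨ v = 3 := by omega
      rcases this with h | h | h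
      exacts [⟨2, 3, 1, by omega⟩, ⟨1, 3, 2, by omega⟩, ⟨1, 2, 3, by omega⟩]
    · exact ⟨1, 2, 3, by omega⟩
  obtain ⟨s, hs4, hsn, hsu, hsv⟩ : ∃ s, 4 ≤ s ∧ s ≤ n ∧ s ≠ u ∧ (4 ≤ v → s = v) := by
    by_cases h : 4 ≤ v
    · exact ⟨v, by omega⟩
    · by_cases h' : u = 4
      exacts [⟨5, by omega⟩, ⟨4, by omega⟩]
  set D := vectorSpan ℝ (separatingVecs n K u v)
  have rel : ∀ p q, (1 ≤ p ∧ p ≤ n) → (1 ≤ q ∧ q ≤ n) → p ≠ q → x ≠ p → x ≠ q → y ≠ p → y ≠ q →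
      (u = p ∨ u = q ∨ v = p ∨ v = q) →
      (2 : ℝ) • edgeVec x y + ((if 4 ≤ p then repVec p else 0) +
        if 4 ≤ q then repVec q else 0) ∈ D := by
    intro p q hp hq hpq hxp hxq hyp hyq h
    obtain ⟨c, cp, cq, hc, hmem⟩ := exists_squareVec_mem n K u v x y p q hK1 hK2
      (mem_Icc.2 hp) (mem_Icc.2 hq) hpq hxp hxq hyp hyq huv
      (Or.inl ⟨by omega, by omega, hvx, hvy, h⟩)
    convert hmem using 1
    have hx' : x ∈ Icc 1 n := mem_Icc.2 (by omega)
    have hy' : y ∈ Icc 1 n := mem_Icc.2 (by omega)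
    refine Prod.ext ?_ ?_
    · rw [squareVec_fst n c x y hx' hy' hxy]
      split_ifs <;> simp [repVec]
    · rw [squareVec_snd n c x y p q hx' hy' (mem_Icc.2 hp) (mem_Icc.2 hq) hpq hxy hxp hxq hyp hyq
        hx.2 hy.2 cp cq hc]
      split_ifs <;> simp [edgeVec]
  have rel_pair : ∀ t, 4 ≤ t → t ≤ n → t ≠ u →
      (2 : ℝ) • edgeVec x y + (repVec u + repVec t) ∈ D := by
    intro t h4 hn htu
    have := rel u t hu (by omega) htu.symm (by omega) (by omega) (by omega) (by omega) (by omega)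
    rwa [if_pos hu4, if_pos h4] at this
  have rel_u : (2 : ℝ) • edgeVec x y + repVec u ∈ D := by
    have := rel z u (by omega) hu (by omega) hxz (by omega) hyz (by omega) (by omega)
    rwa [if_neg (by omega), if_pos hu4, zero_add] at this
  have rel_s : (2 : ℝ) • edgeVec x y + repVec s ∈ D := by
    have := rel z s (by omega) (by omega) (by omega) hxz (by omega) hyz (by omega) (by omega)
    rwa [if_neg (by omega), if_pos hs4, zero_add] at this
  have rep : ∀ t, 4 ≤ t → t ≤ n → t ≠ u → repVec t ∈ D := by
    intro t h4 hn htu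
    convert D.sub_mem (rel_pair t h4 hn htu) rel_u using 1
    abel
  by_cases hwu : w = u
  · subst hwu
    convert D.sub_mem (D.add_mem rel_u (rep s hs4 hsn hsu)) rel_s using 1
    abel
  · exact rep w hw.1 hw.2 hwu

theorem edgeVec_mem_vectorSpan (n K u v : ℕ) (hK1 : 3 ≤ K) (hK2 : K + 2 ≤ n) (hu : u ∈ Icc 1 n)
    (hv : v ∈ Icc 1 n) (huv : u ≠ v) (hu4 : 4 ≤ u) (x y : ℕ) (hx : x ∈ Icc 1 n)
    (hy : y ∈ Icc 1 n) (hxy : x ≠ y) (hne : ¬(x = u ∧ y = v)) (hne' : ¬(x = v ∧ y = u)) :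
    edgeVec x y ∈ vectorSpan ℝ (separatingVecs n K u v) := by
  have avoid : ∀ a b c : ℕ, ∃ p ∈ Icc 1 n, ∃ q ∈ Icc 1 n, p ≠ q ∧
      p ≠ a ∧ p ≠ b ∧ p ≠ c ∧ q ≠ a ∧ q ≠ b ∧ q ≠ c := by
    intro a b c
    have h1 := le_card_sdiff ({a, b, c} : Finset ℕ) (Icc 1 n)
    have h2 := card_le_three (a := a) (b := b) (c := c)
    simp only [Nat.card_Icc] at h1
    obtain ⟨p, hp, q, hq, hpq⟩ := one_lt_card.1 (show 1 < (Icc 1 n \ {a, b, c}).card by omega)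
    simp only [mem_sdiff, mem_insert, mem_singleton, not_or] at hp hq
    exact ⟨p, hp.1, q, hq.1, hpq, hp.2.1, hp.2.2.1, hp.2.2.2, hq.2.1, hq.2.2.1, hq.2.2.2⟩
  obtain ⟨p, hp, q, hq, hpq, hxp, hxq, hyp, hyq, hsep⟩ : ∃ p ∈ Icc 1 n, ∃ q ∈ Icc 1 n, p ≠ q ∧
      x ≠ p ∧ x ≠ q ∧ y ≠ p ∧ y ≠ q ∧
      ((u ≠ x ∧ u ≠ y ∧ v ≠ x ∧ v ≠ y ∧ (u = p ∨ u = q ∨ v = p ∨ v = q)) ∨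
      ((u = x ∨ u = y) ∧ v ≠ x ∧ v ≠ y ∧ v ≠ p ∧ v ≠ q) ∨
      ((v = x ∨ v = y) ∧ u ≠ x ∧ u ≠ y ∧ u ≠ p ∧ u ≠ q)) := by
    by_cases h₁ : u = x ∨ u = y
    · obtain ⟨p, hp, q, hq, h⟩ := avoid x y v
      exact ⟨p, hp, q, hq, by omega⟩
    · by_cases h₂ : v = x ∨ v = y
      · obtain ⟨p, hp, q, hq, h⟩ := avoid x y u
        exact ⟨p, hp, q, hq, by omega⟩
      · exact ⟨u, hu, v, hv, by omega⟩
  obtain ⟨c, -, -, -, hmem⟩ := exists_squareVec_mem n K u v x y p q hK1 hK2 hp hq hpq hxp hxq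
    hyp hyq huv hsep
  set D := vectorSpan ℝ (separatingVecs n K u v)
  have hrep : ((0, (squareVec n c x y).2) : GPoint) ∈ D := by
    rw [sum_smul_repVec n _ fun w hw => squareVec_snd_eq_zero n c x y w hw]
    exact D.sum_mem fun w hw =>
      D.smul_mem _ (repVec_mem_vectorSpan n K u v hK1 hK2 hu hv huv hu4 w hw)
  have : edgeVec x y = (2⁻¹ : ℝ) • (squareVec n c x y - (0, (squareVec n c x y).2)) := by
    refine Prod.ext ?_ ?_
    · simp [squareVec_fst n c x y hx hy hxy]
    · simp [edgeVec]
  rw [this]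
  exact D.smul_mem _ (D.sub_mem hmem hrep)

theorem finite_charVecs (n K : ℕ) : {x | ∃ π : KPartition n K, x = charVec n K π}.Finite := by
  have hinj : Function.Injective (KPartition.parts : KPartition n K → _) := by
    rintro ⟨⟩ ⟨⟩ h
    simpa using h
  have : Finite (KPartition n K) := by
    refine Set.finite_univ_iff.1 (Set.Finite.of_finite_image (f := KPartition.parts) ?_ hinj.injOn)
    refine ((Icc 1 n).powerset.powerset.finite_toSet).subset ?_
    rintro _ ⟨π, -, rfl⟩
    refine mem_coe.2 (mem_powerset.2 fun C hC => mem_powerset.2 ?_)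
    rw [← π.parts_cover]
    exact le_sup (f := id) hC
  refine (Set.finite_range (charVec n K)).subset ?_
  rintro _ ⟨π, rfl⟩
  exact ⟨π, rfl⟩

/-- The coordinate of the edge `ij`, as a linear form. -/
noncomputable def edgeCoord (i j : ℕ) : GPoint →ₗ[ℝ] ℝ :=
  LinearMap.proj (i, j) ∘ₗ LinearMap.fst ℝ (ℕ × ℕ → ℝ) (ℕ → ℝ)

/-- The representative coordinate of `w`, as a linear form. -/
noncomputable def repCoord (w : ℕ) : GPoint →ₗ[ℝ] ℝ :=
  LinearMap.proj w ∘ₗ LinearMap.snd ℝ (ℕ × ℕ → ℝ) (ℕ → ℝ)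

/-- On partitions that do not put `1`, `2`, `3` into one cluster this form equals `K - 3`. -/
noncomputable def triangleForm (n : ℕ) : GPoint →ₗ[ℝ] ℝ :=
  ∑ w ∈ Icc 4 n, repCoord w - (edgeCoord 1 2 + edgeCoord 1 3 + edgeCoord 2 3)

theorem edgeCoord_apply (i j : ℕ) (x : GPoint) : edgeCoord i j x = x.1 (i, j) := rfl

theorem triangleForm_apply (n : ℕ) (x : GPoint) :
    triangleForm n x = ∑ w ∈ Icc 4 n, x.2 w - (x.1 (1, 2) + x.1 (1, 3) + x.1 (2, 3)) := by
  simp [triangleForm, LinearMap.sum_apply, edgeCoord, repCoord]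

theorem vectorSpan_le_ker (S : Set GPoint) (φ : GPoint →ₗ[ℝ] ℝ) (b : ℝ)
    (h : ∀ x ∈ S, φ x = b) : vectorSpan ℝ S ≤ LinearMap.ker φ := by
  rw [vectorSpan_def, Submodule.span_le]
  rintro _ ⟨x, hx, y, hy, rfl⟩
  simp [h x hx, h y hy]

namespace KPartition

variable {n K : ℕ} (π : KPartition n K)

/-- `i` and `j` lie in the same cluster. -/
def Together (i j : ℕ) : Prop := ∃ C ∈ π.parts, i ∈ C ∧ j ∈ C

/-- `w` is the smallest element of its cluster. -/
def IsRep (w : ℕ) : Prop := ∃ C ∈ π.parts, w ∈ C ∧ ∀ i ∈ C, w ≤ i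

theorem exists_mem_part {i : ℕ} (hi : i ∈ Icc 1 n) : ∃ C ∈ π.parts, i ∈ C := by
  rw [← π.parts_cover] at hi
  simpa [mem_sup] using hi

theorem mem_Icc_of_mem {C : Finset ℕ} (hC : C ∈ π.parts) {i : ℕ} (hi : i ∈ C) : i ∈ Icc 1 n := by
  rw [← π.parts_cover]
  exact le_sup (f := id) hC hi

theorem eq_of_mem {C D : Finset ℕ} (hC : C ∈ π.parts) (hD : D ∈ π.parts) {i : ℕ} (h : i ∈ C)
    (h' : i ∈ D) : C = D := by
  by_contra hne
  exact disjoint_left.1 (π.parts_disjoint C hC D hD hne) h h'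

theorem Together.symm {i j : ℕ} (h : π.Together i j) : π.Together j i :=
  h.imp fun _ hC => ⟨hC.1, hC.2.2, hC.2.1⟩

theorem Together.trans {i j k : ℕ} (h : π.Together i j) (h' : π.Together j k) :
    π.Together i k := by
  obtain ⟨C, hC, hi, hj⟩ := h
  obtain ⟨D, hD, hj', hk⟩ := h'
  obtain rfl := π.eq_of_mem hC hD hj hj'
  exact ⟨C, hC, hi, hk⟩

theorem isRep_iff {w : ℕ} (hw : w ∈ Icc 1 n) :
    π.IsRep w ↔ ∀ i < w, ¬π.Together i w := by
  constructor
  · rintro ⟨C, hC, hwC, hmin⟩ i hi ⟨D, hD, hiD, hwD⟩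
    obtain rfl := π.eq_of_mem hC hD hwC hwD
    exact absurd (hmin i hiD) (by omega)
  · intro h
    obtain ⟨C, hC, hwC⟩ := π.exists_mem_part hw
    refine ⟨C, hC, hwC, fun i hi => ?_⟩
    by_contra hlt
    exact h i (by omega) ⟨C, hC, hi, hwC⟩

open Classical in
theorem card_isRep : ((Icc 1 n).filter π.IsRep).card = K := by
  refine Eq.trans (Eq.symm ?_) π.card_parts
  refine card_bij (fun C hC => C.min' (π.parts_nonempty C hC)) ?_ ?_ ?_
  · intro C hC
    have hmem := C.min'_mem (π.parts_nonempty C hC)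
    exact mem_filter.2 ⟨π.mem_Icc_of_mem hC hmem, C, hC, hmem, fun i hi => C.min'_le i hi⟩
  · intro C hC D hD h
    refine π.eq_of_mem hC hD (C.min'_mem (π.parts_nonempty C hC)) ?_
    rw [h]
    exact D.min'_mem _
  · intro w hw
    obtain ⟨C, hC, hwC, hmin⟩ := (mem_filter.1 hw).2
    exact ⟨C, hC, le_antisymm (C.min'_le w hwC) (C.le_min' _ _ hmin)⟩

open Classical in
theorem triangleForm_charVec (hn : 3 ≤ n) :
    triangleForm n (charVec n K π) =
      K - 3 - if π.Together 1 2 ∧ π.Together 1 3 ∧ π.Together 2 3 then 1 else 0 := by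
  have hnot0 : ∀ j, ¬π.Together 0 j := by
    rintro j ⟨C, hC, h0, -⟩
    simpa using π.mem_Icc_of_mem hC h0
  have h1 : π.IsRep 1 := by
    rw [π.isRep_iff (mem_Icc.2 (by omega))]
    intro i hi
    obtain rfl : i = 0 := by omega
    exact hnot0 1
  have h2 : π.IsRep 2 ↔ ¬π.Together 1 2 := by
    rw [π.isRep_iff (mem_Icc.2 (by omega))]
    refine ⟨fun h => h 1 (by omega), fun h i hi => ?_⟩
    interval_cases i
    exacts [hnot0 2, h]
  have h3 : π.IsRep 3 ↔ ¬π.Together 1 3 ∧ ¬π.Together 2 3 := by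
    rw [π.isRep_iff (mem_Icc.2 (by omega))]
    refine ⟨fun h => ⟨h 1 (by omega), h 2 (by omega)⟩, fun h i hi => ?_⟩
    interval_cases i
    exacts [hnot0 3, h.1, h.2]
  have hsum : (∑ w ∈ Icc 4 n, if π.IsRep w then (1 : ℝ) else 0) +
      ((if π.IsRep 1 then 1 else 0) + (if π.IsRep 2 then 1 else 0) +
        if π.IsRep 3 then 1 else 0) = K := by
    have hcard : ∑ w ∈ Icc 1 n, (if π.IsRep w then (1 : ℝ) else 0) = K := by
      rw [sum_boole, π.card_isRep]
    have hset : Icc 1 n = Icc 4 n ∪ {1, 2, 3} := by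
      ext i; simp only [mem_Icc, mem_union, mem_insert, mem_singleton]; omega
    rw [hset, sum_union (by
      rw [disjoint_left]; intro i
      simp only [mem_Icc, mem_insert, mem_singleton]; omega)] at hcard
    rw [← hcard]
    rw [sum_insert (by decide), sum_insert (by decide), sum_singleton]
    ring
  have hrep : ∑ w ∈ Icc 4 n, (charVec n K π).2 w =
      ∑ w ∈ Icc 4 n, if π.IsRep w then (1 : ℝ) else 0 :=
    sum_congr rfl fun w hw => ite_one_zero_congr (and_iff_right (mem_Icc.1 hw).1)
  have hedge : ∀ i j, (charVec n K π).1 (i, j) = if π.Together i j then 1 else 0 :=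
    fun i j => ite_one_zero_congr Iff.rfl
  rw [triangleForm_apply, hrep, hedge, hedge, hedge, eq_sub_of_add_eq hsum]
  have t₁ : π.Together 1 2 → π.Together 1 3 → π.Together 2 3 := fun h h' => h.symm.trans π h'
  have t₂ : π.Together 1 2 → π.Together 2 3 → π.Together 1 3 := fun h h' => h.trans π h'
  have t₃ : π.Together 1 3 → π.Together 2 3 → π.Together 1 2 := fun h h' => h.trans π h'.symm
  by_cases a : π.Together 1 2 <;> by_cases b : π.Together 1 3 <;> by_cases c : π.Together 2 3 <;>
    simp_all <;> ring

end KPartition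

theorem charVec_mem_PolyP (n K : ℕ) (π : KPartition n K) : charVec n K π ∈ PolyP n K :=
  subset_convexHull ℝ _ ⟨π, rfl⟩

theorem edgeCoord_nonneg (n K u v : ℕ) (x : GPoint) (hx : x ∈ PolyP n K) : 0 ≤ x.1 (u, v) := by
  refine convexHull_min ?_ ((convex_Ici (0 : ℝ)).linear_preimage (edgeCoord u v)) hx
  rintro _ ⟨π, rfl⟩
  simp only [Set.mem_preimage, Set.mem_Ici, edgeCoord_apply, charVec]
  split_ifs <;> norm_num

theorem triangleForm_eq_of_mem_face (n K u v : ℕ) (hn : 3 ≤ n) (hu : u ∈ Icc 1 n)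
    (hv : v ∈ Icc 1 n) (huv : u ≠ v) (hu3 : u ≤ 3) (hv3 : v ≤ 3) (x : GPoint)
    (hx : x ∈ PolyP n K) (hxuv : x.1 (u, v) = 0) : triangleForm n x = K - 3 := by
  classical
  have upper : triangleForm n x ≤ K - 3 := by
    refine convexHull_min ?_ ((convex_Iic (K - 3 : ℝ)).linear_preimage (triangleForm n)) hx
    rintro _ ⟨π, rfl⟩
    simp only [Set.mem_preimage, Set.mem_Iic, π.triangleForm_charVec hn]
    split_ifs <;> norm_num
  have lower : (K - 3 : ℝ) ≤ (triangleForm n + edgeCoord u v) x := by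
    refine convexHull_min ?_
      ((convex_Ici (K - 3 : ℝ)).linear_preimage (triangleForm n + edgeCoord u v)) hx
    rintro _ ⟨π, rfl⟩
    simp only [Set.mem_preimage, Set.mem_Ici, LinearMap.add_apply, π.triangleForm_charVec hn]
    have hedge : edgeCoord u v (charVec n K π) = if π.Together u v then 1 else 0 :=
      ite_one_zero_congr Iff.rfl
    rw [hedge]
    have himp : π.Together 1 2 ∧ π.Together 1 3 ∧ π.Together 2 3 → π.Together u v := by
      rintro ⟨h₁, h₂, h₃⟩
      simp only [mem_Icc] at hu hv
      have := h₁.symm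
      have := h₂.symm
      have := h₃.symm
      interval_cases u <;> interval_cases v <;> first | assumption | omega
    split_ifs with h h' <;> first | exact absurd (himp h) h' | norm_num
  rw [LinearMap.add_apply, edgeCoord_apply, hxuv, add_zero] at lower
  exact le_antisymm upper lower

theorem vectorSpan_PolyP (n K : ℕ) :
    vectorSpan ℝ (PolyP n K) = vectorSpan ℝ {x | ∃ π : KPartition n K, x = charVec n K π} := by
  rw [← direction_affineSpan, PolyP, affineSpan_convexHull, direction_affineSpan]

theorem finiteDimensional_vectorSpan_PolyP (n K : ℕ) :
    FiniteDimensional ℝ (vectorSpan ℝ (PolyP n K)) := by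
  rw [vectorSpan_PolyP]
  exact finiteDimensional_vectorSpan_of_finite ℝ (finite_charVecs n K)

theorem vectorSpan_PolyP_le (n K : ℕ) (M : Submodule ℝ GPoint)
    (hE : ∀ i ∈ Icc 1 n, ∀ j ∈ Icc 1 n, i ≠ j → edgeVec i j ∈ M)
    (hR : ∀ w ∈ Icc 4 n, repVec w ∈ M) : vectorSpan ℝ (PolyP n K) ≤ M := by
  classical
  rw [vectorSpan_PolyP, vectorSpan_def, Submodule.span_le]
  rintro _ ⟨_, ⟨π, rfl⟩, _, ⟨ρ, rfl⟩, rfl⟩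
  have diag : ∀ (σ : KPartition n K) i, i ∈ Icc 1 n → (charVec n K σ).1 (i, i) = 1 :=
    fun σ i hi => if_pos <| (σ.exists_mem_part hi).imp fun C hC => ⟨hC.1, hC.2, hC.2⟩
  have out : ∀ (σ : KPartition n K) i j, ¬(i ∈ Icc 1 n ∧ j ∈ Icc 1 n) →
      (charVec n K σ).1 (i, j) = 0 := fun σ i j h => if_neg fun ⟨C, hC, hi, hj⟩ =>
    h ⟨σ.mem_Icc_of_mem hC hi, σ.mem_Icc_of_mem hC hj⟩
  have rep : ∀ (σ : KPartition n K) w, w ∉ Icc 4 n → (charVec n K σ).2 w = 0 :=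
    fun σ w hw => if_neg fun ⟨h4, C, hC, hwC, _⟩ =>
      hw (mem_Icc.2 ⟨h4, (mem_Icc.1 (σ.mem_Icc_of_mem hC hwC)).2⟩)
  refine mem_of_edgeVec_mem_of_repVec_mem n M hE hR _ (fun i j h => ?_) (fun i j => ?_)
    fun w hw => ?_
  · simp only [vsub_eq_sub, Prod.fst_sub, Pi.sub_apply]
    by_cases hij : i ∈ Icc 1 n ∧ j ∈ Icc 1 n
    · obtain rfl : i = j := by
        by_contra hne
        exact h ⟨hij.1, hij.2, hne⟩
      rw [diag π i hij.1, diag ρ i hij.1, sub_self]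
    · rw [out π i j hij, out ρ i j hij, sub_self]
  · simp only [vsub_eq_sub, Prod.fst_sub, Pi.sub_apply, charVec_symm n K _ i j]
  · simp only [vsub_eq_sub, Prod.snd_sub, Pi.sub_apply, rep π w hw, rep ρ w hw, sub_self]

theorem vectorSpan_separatingVecs_le_PolyP (n K u v : ℕ) :
    vectorSpan ℝ (separatingVecs n K u v) ≤ vectorSpan ℝ (PolyP n K) := by
  refine vectorSpan_mono ℝ ?_
  rintro _ ⟨π, rfl, -⟩
  exact charVec_mem_PolyP n K π

theorem repVec_mem_vectorSpan_PolyP (n K : ℕ) (hK1 : 3 ≤ K) (hK2 : K + 2 ≤ n) (w : ℕ)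
    (hw : w ∈ Icc 4 n) : repVec w ∈ vectorSpan ℝ (PolyP n K) :=
  vectorSpan_separatingVecs_le_PolyP n K 4 1 <| repVec_mem_vectorSpan n K 4 1 hK1 hK2
    (mem_Icc.2 (by omega)) (mem_Icc.2 (by omega)) (by norm_num) le_rfl w hw

theorem edgeVec_mem_vectorSpan_PolyP (n K : ℕ) (hK1 : 3 ≤ K) (hK2 : K + 2 ≤ n) (x y : ℕ)
    (hx : x ∈ Icc 1 n) (hy : y ∈ Icc 1 n) (hxy : x ≠ y) :
    edgeVec x y ∈ vectorSpan ℝ (PolyP n K) := by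
  obtain ⟨u, hu4, hu5, h, h'⟩ : ∃ u, 4 ≤ u ∧ u ≤ 5 ∧ ¬(x = u ∧ y = 1) ∧ ¬(x = 1 ∧ y = u) := by
    by_cases h : (x = 4 ∧ y = 1) ∨ (x = 1 ∧ y = 4)
    exacts [⟨5, by omega⟩, ⟨4, by omega⟩]
  exact vectorSpan_separatingVecs_le_PolyP n K u 1 <| edgeVec_mem_vectorSpan n K u 1 hK1 hK2
    (mem_Icc.2 (by omega)) (mem_Icc.2 (by omega)) (by omega) hu4 x y hx hy hxy h h'

theorem edgeCoord_edgeVec (u v : ℕ) (huv : u ≠ v) : edgeCoord u v (edgeVec u v) = 1 := by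
  simp [edgeCoord_apply, edgeVec, huv]

theorem isFacetGe_edge (n K u v : ℕ) (hK1 : 3 ≤ K) (hK2 : K + 2 ≤ n) (hu : u ∈ Icc 1 n)
    (hv : v ∈ Icc 1 n) (huv : u ≠ v) (h4 : 4 ≤ u ∨ 4 ≤ v) :
    IsFacetGe n K (fun x => x.1 (u, v)) 0 := by
  refine ⟨fun x hx => edgeCoord_nonneg n K u v x hx, ?_⟩
  rw [adim, adim, direction_affineSpan, direction_affineSpan]
  set D := vectorSpan ℝ {x | x ∈ PolyP n K ∧ x.1 (u, v) = 0}
  have hsub : vectorSpan ℝ (separatingVecs n K u v) ≤ D := by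
    refine vectorSpan_mono ℝ ?_
    rintro _ ⟨π, rfl, h⟩
    exact ⟨charVec_mem_PolyP n K π, h⟩
  have hR : ∀ w ∈ Icc 4 n, repVec w ∈ D := fun w hw => hsub <| by
    rcases h4 with h | h
    · exact repVec_mem_vectorSpan n K u v hK1 hK2 hu hv huv h w hw
    · rw [separatingVecs_comm]
      exact repVec_mem_vectorSpan n K v u hK1 hK2 hv hu huv.symm h w hw
  have hE : ∀ i ∈ Icc 1 n, ∀ j ∈ Icc 1 n, i ≠ j → ¬(i = u ∧ j = v) → ¬(i = v ∧ j = u) →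
      edgeVec i j ∈ D := fun i hi j hj hij hne hne' => hsub <| by
    rcases h4 with h | h
    · exact edgeVec_mem_vectorSpan n K u v hK1 hK2 hu hv huv h i j hi hj hij hne hne'
    · rw [separatingVecs_comm]
      exact edgeVec_mem_vectorSpan n K v u hK1 hK2 hv hu huv.symm h i j hi hj hij hne' hne
  have hle : vectorSpan ℝ (PolyP n K) ≤ D ⊔ Submodule.span ℝ {edgeVec u v} := by
    have huvmem : edgeVec u v ∈ D ⊔ Submodule.span ℝ {edgeVec u v} :=
      Submodule.mem_sup_right (Submodule.mem_span_singleton_self _)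
    refine vectorSpan_PolyP_le n K _ (fun i hi j hj hij => ?_)
      fun w hw => Submodule.mem_sup_left (hR w hw)
    by_cases h : i = u ∧ j = v
    · rwa [h.1, h.2]
    by_cases h' : i = v ∧ j = u
    · rwa [edgeVec_comm i j, h'.1, h'.2]
    exact Submodule.mem_sup_left (hE i hi j hj hij h h')
  have hfin := finiteDimensional_vectorSpan_PolyP n K
  have hDP : D ≤ vectorSpan ℝ (PolyP n K) := vectorSpan_mono ℝ fun x hx => hx.1
  have hfinD : FiniteDimensional ℝ D := Submodule.finiteDimensional_of_le hDP
  have hker : D ≤ LinearMap.ker (edgeCoord u v) :=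
    vectorSpan_le_ker _ (edgeCoord u v) 0 fun x hx => hx.2
  have hlt : D < vectorSpan ℝ (PolyP n K) := by
    refine lt_of_le_of_ne hDP fun heq => ?_
    have := hker (heq ▸ edgeVec_mem_vectorSpan_PolyP n K hK1 hK2 u v hu hv huv)
    simp [LinearMap.mem_ker, edgeCoord_edgeVec u v huv] at this
  have h₁ := Submodule.finrank_lt_finrank_of_lt hlt
  have h₂ := Submodule.finrank_mono hle
  have h₃ := Submodule.finrank_add_le_finrank_add_finrank D (Submodule.span ℝ {edgeVec u v})
  have hne : edgeVec u v ≠ 0 := fun h => by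
    simpa [h] using edgeCoord_edgeVec u v huv
  rw [finrank_span_singleton hne] at h₃
  omega

theorem not_isFacetGe_edge (n K u v : ℕ) (hK1 : 3 ≤ K) (hK2 : K + 2 ≤ n) (hu : u ∈ Icc 1 n)
    (hv : v ∈ Icc 1 n) (huv : u ≠ v) (hu3 : u ≤ 3) (hv3 : v ≤ 3) :
    ¬IsFacetGe n K (fun x => x.1 (u, v)) 0 := by
  rintro ⟨-, h⟩
  rw [adim, adim, direction_affineSpan, direction_affineSpan] at h
  set D := vectorSpan ℝ {x | x ∈ PolyP n K ∧ x.1 (u, v) = 0}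
  set P := vectorSpan ℝ (PolyP n K)
  have hfin : FiniteDimensional ℝ P := finiteDimensional_vectorSpan_PolyP n K
  have hfin' : FiniteDimensional ℝ ↥(P ⊓ LinearMap.ker (edgeCoord u v)) :=
    Submodule.finiteDimensional_of_le inf_le_left
  have hDP : D ≤ P := vectorSpan_mono ℝ fun x hx => hx.1
  have hker : D ≤ LinearMap.ker (edgeCoord u v) :=
    vectorSpan_le_ker _ (edgeCoord u v) 0 fun x hx => hx.2
  have hker' : D ≤ LinearMap.ker (triangleForm n) :=
    vectorSpan_le_ker _ (triangleForm n) (K - 3) fun x hx =>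
      triangleForm_eq_of_mem_face n K u v (by omega) hu hv huv hu3 hv3 x hx.1 hx.2
  have hlt₁ : P ⊓ LinearMap.ker (edgeCoord u v) < P := by
    refine lt_of_le_of_ne inf_le_left fun heq => ?_
    have := (inf_eq_left.1 heq) (edgeVec_mem_vectorSpan_PolyP n K hK1 hK2 u v hu hv huv)
    simp [LinearMap.mem_ker, edgeCoord_edgeVec u v huv] at this
  have hlt₂ : D < P ⊓ LinearMap.ker (edgeCoord u v) := by
    refine lt_of_le_of_ne (le_inf hDP hker) fun heq => ?_
    have h4 : 4 ∈ Icc 4 n := mem_Icc.2 (by omega)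
    have hmem : repVec 4 ∈ D := by
      rw [heq]
      exact ⟨repVec_mem_vectorSpan_PolyP n K hK1 hK2 4 h4, rfl⟩
    have := hker' hmem
    rw [LinearMap.mem_ker, triangleForm_apply] at this
    simp [repVec, Pi.single_apply] at this
    omega
  have h₁ := Submodule.finrank_lt_finrank_of_lt hlt₁
  have h₂ := Submodule.finrank_lt_finrank_of_lt hlt₂
  omega

/-- For `n ≥ 5` and `3 ≤ K ≤ n-2` and an edge `uv ∈ E`, the inequality `x_{u,v} ≥ 0` is
facet-defining for `P_{n,K}` iff `uv ∉ {{1,2},{1,3},{2,3}}`. -/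
theorem edge_nonneg_facet (n K u v : ℕ) (hn : 5 ≤ n) (hK1 : 3 ≤ K) (hK2 : K ≤ n - 2)
    (hu : u ∈ Finset.Icc 1 n) (hv : v ∈ Finset.Icc 1 n) (huv : u ≠ v) :
    IsFacetGe n K (fun x => x.1 (u, v)) 0 ↔
      (({u, v} : Finset ℕ) ≠ {1, 2} ∧ ({u, v} : Finset ℕ) ≠ {1, 3} ∧
        ({u, v} : Finset ℕ) ≠ {2, 3}) := by
  have hle : u ≤ 3 ∧ v ≤ 3 ↔ ({u, v} : Finset ℕ) = {1, 2} ∨ ({u, v} : Finset ℕ) = {1, 3} ∨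
      ({u, v} : Finset ℕ) = {2, 3} := by
    constructor
    · rintro ⟨hu3, hv3⟩
      have hu1 := (mem_Icc.1 hu).1
      have hv1 := (mem_Icc.1 hv).1
      clear hu hv
      interval_cases u <;> interval_cases v <;> first | omega | decide
    · have bound : ∀ s : Finset ℕ, {u, v} = s → (∀ i ∈ s, i ≤ 3) → u ≤ 3 ∧ v ≤ 3 := by
        rintro _ rfl h
        exact ⟨h u (by simp), h v (by simp)⟩
      rintro (h | h | h) <;> exact bound _ h (by simp)
  have hK2' : K + 2 ≤ n := by omega
  constructor
  · intro hF
    have : ¬(u ≤ 3 ∧ v ≤ 3) := fun h =>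
      not_isFacetGe_edge n K u v hK1 hK2' hu hv huv h.1 h.2 hF
    rw [hle] at this
    tauto
  · intro hne
    refine isFacetGe_edge n K u v hK1 hK2' hu hv huv ?_
    have : ¬(u ≤ 3 ∧ v ≤ 3) := by
      rw [hle]
      tauto
    omega
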